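/- arXiv:2306.08187 — 2 statements merged into one kernel-verified Lean document; each statement's English description precedes it below -/
import Mathlib

section
/- For all positive edge weights c₁, c₂ on the path P₃, the product of the algebraic connectivity and the total effective resistance satisfies λ₂(c₁,c₂) · (2/c₁ + 2/c₂) ≤ 4, with equality if and only if c₁ = c₂. -/
open Matrix

/-- The Laplacian of the weighted path `P₃` with edge weights `c₁, c₂`. -/
noncomputable def lapP3 (c₁ c₂ : ℝ) : Matrix (Fin 3) (Fin 3) ℝ :=
  !![c₁, -c₁, 0; -c₁, c₁ + c₂, -c₂; 0, -c₂, c₂]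

/-- The algebraic connectivity `λ₂` of the weighted path `P₃`: the minimum (here: infimum,
which is attained) of the Rayleigh quotient `⟨Lx, x⟩ / ⟨x, x⟩` over nonzero `x ∈ ℝ³` with
`x₁ + x₂ + x₃ = 0`; equivalently, the second smallest eigenvalue of the Laplacian. -/
noncomputable def lambda2P3 (c₁ c₂ : ℝ) : ℝ :=
  sInf {R : ℝ | ∃ x : Fin 3 → ℝ, x ≠ 0 ∧ x 0 + x 1 + x 2 = 0 ∧
    R = ((lapP3 c₁ c₂).mulVec x ⬝ᵥ x) / (x ⬝ᵥ x)}

theorem lapP3_mulVec_dotProduct (c₁ c₂ : ℝ) (x : Fin 3 → ℝ) :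
    (lapP3 c₁ c₂).mulVec x ⬝ᵥ x = c₁ * (x 0 - x 1) ^ 2 + c₂ * (x 1 - x 2) ^ 2 := by
  simp [lapP3, Matrix.mulVec, dotProduct, Fin.sum_univ_three]
  ring

theorem lambda2P3_le_rayleigh {c₁ c₂ : ℝ} (hc₁ : 0 ≤ c₁) (hc₂ : 0 ≤ c₂) {x : Fin 3 → ℝ}
    (hx : x ≠ 0) (hsum : x 0 + x 1 + x 2 = 0) :
    lambda2P3 c₁ c₂ ≤ ((lapP3 c₁ c₂).mulVec x ⬝ᵥ x) / (x ⬝ᵥ x) := by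
  refine csInf_le ⟨0, ?_⟩ ⟨x, hx, hsum, rfl⟩
  rintro _ ⟨y, -, -, rfl⟩
  rw [lapP3_mulVec_dotProduct]
  have hy : 0 ≤ y ⬝ᵥ y := dotProduct_self_star_nonneg y
  positivity

/-- The test vector whose differences along the edges are inversely proportional to the
weights bounds the algebraic connectivity from above. -/
theorem lambda2P3_le {c₁ c₂ : ℝ} (hc₁ : 0 < c₁) (hc₂ : 0 < c₂) :
    lambda2P3 c₁ c₂ ≤ 3 * c₁ * c₂ * (c₁ + c₂) / (2 * (c₁ ^ 2 + c₁ * c₂ + c₂ ^ 2)) := by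
  have hx : ![c₁ + 2 * c₂, c₁ - c₂, -2 * c₁ - c₂] ≠ 0 := fun h => by
    have h0 := congrFun h 0
    simp at h0
    linarith
  refine (lambda2P3_le_rayleigh hc₁.le hc₂.le hx (by simp; ring)).trans_eq ?_
  have hnorm : ![c₁ + 2 * c₂, c₁ - c₂, -2 * c₁ - c₂] ⬝ᵥ ![c₁ + 2 * c₂, c₁ - c₂, -2 * c₁ - c₂] =
      6 * (c₁ ^ 2 + c₁ * c₂ + c₂ ^ 2) := by
    simp [dotProduct, Fin.sum_univ_three]
    ring
  rw [lapP3_mulVec_dotProduct, hnorm, div_eq_div_iff (by positivity) (by positivity)]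
  simp
  ring

theorem le_lambda2P3_self {c : ℝ} (hc : 0 ≤ c) : c ≤ lambda2P3 c c := by
  refine le_csInf ⟨_, ![1, 0, -1], fun h => by simpa using congrFun h 0, by simp, rfl⟩ ?_
  rintro _ ⟨x, hx, hsum, rfl⟩
  have hpos : 0 < x ⬝ᵥ x :=
    lt_of_le_of_ne (dotProduct_self_star_nonneg x) (Ne.symm (dotProduct_self_eq_zero.not.mpr hx))
  have hx1 : x 1 = -x 0 - x 2 := by linarith
  rw [le_div_iff₀ hpos, lapP3_mulVec_dotProduct, ← sub_nonneg]
  have key : c * (x 0 - x 1) ^ 2 + c * (x 1 - x 2) ^ 2 - c * (x ⬝ᵥ x) =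
      3 * c * (x 0 + x 2) ^ 2 := by
    simp only [dotProduct, Fin.sum_univ_three, hx1]
    ring
  rw [key]
  positivity

theorem lambda2P3_mul_resistance_le {c₁ c₂ : ℝ} (hc₁ : 0 < c₁) (hc₂ : 0 < c₂) :
    lambda2P3 c₁ c₂ * (2 / c₁ + 2 / c₂) ≤
      4 - (c₁ - c₂) ^ 2 / (c₁ ^ 2 + c₁ * c₂ + c₂ ^ 2) := by
  refine (mul_le_mul_of_nonneg_right (lambda2P3_le hc₁ hc₂) (by positivity)).trans_eq ?_
  field_simp
  ring

/-- **The maximal product of algebraic connectivity and total effective resistance for `P₃`.**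
For all positive edge weights `c₁, c₂` on the path `P₃`, the algebraic connectivity and
the total effective resistance `R = 2/c₁ + 2/c₂` satisfy
`λ₂(c₁, c₂) * (2/c₁ + 2/c₂) ≤ 4`, with equality iff `c₁ = c₂`. -/
theorem lambda2P3_mul_resistance_le_four
    (c₁ c₂ : ℝ) (hc₁ : 0 < c₁) (hc₂ : 0 < c₂) :
    lambda2P3 c₁ c₂ * (2 / c₁ + 2 / c₂) ≤ 4 ∧
    (lambda2P3 c₁ c₂ * (2 / c₁ + 2 / c₂) = 4 ↔ c₁ = c₂) := by
  have hle := lambda2P3_mul_resistance_le hc₁ hc₂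
  have hdef : 0 ≤ (c₁ - c₂) ^ 2 / (c₁ ^ 2 + c₁ * c₂ + c₂ ^ 2) := by positivity
  refine ⟨by linarith, fun heq => ?_, ?_⟩
  · by_contra hne
    have hsub : c₁ - c₂ ≠ 0 := sub_ne_zero.mpr hne
    have : 0 < (c₁ - c₂) ^ 2 / (c₁ ^ 2 + c₁ * c₂ + c₂ ^ 2) := by positivity
    linarith
  · rintro rfl
    refine le_antisymm (by linarith) ?_
    calc (4 : ℝ) = c₁ * (2 / c₁ + 2 / c₁) := by field_simp; norm_num
      _ ≤ _ := mul_le_mul_of_nonneg_right (le_lambda2P3_self hc₁.le) (by positivity)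
end

section
/- Suppose c₁, c₂, c₃ > 0 are edge weights on the path P₄ satisfying 3/c₁ + 4/c₂ + 3/c₃ = 10, and suppose they maximize the algebraic connectivity subject to this constraint, i.e. λ₂(c₁,c₂,c₃) ≥ λ₂(c₁',c₂',c₃') for all positive weights c₁',c₂',c₃' with 3/c₁' + 4/c₂' + 3/c₃' = 10. Then c₁ = c₃. -/
open Matrix

/-- The Laplacian of the weighted path `P₄` with edge weights `c₁, c₂, c₃`. -/
noncomputable def lapP4 (c₁ c₂ c₃ : ℝ) : Matrix (Fin 4) (Fin 4) ℝ :=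
  !![c₁, -c₁, 0, 0; -c₁, c₁ + c₂, -c₂, 0; 0, -c₂, c₂ + c₃, -c₃; 0, 0, -c₃, c₃]

/-- The algebraic connectivity `λ₂` of the weighted path `P₄`: the minimum (here: infimum,
which is attained) of the Rayleigh quotient `⟨Lx, x⟩ / ⟨x, x⟩` over nonzero `x ∈ ℝ⁴` with
`x₁ + x₂ + x₃ + x₄ = 0`; equivalently, the second smallest eigenvalue of the Laplacian. -/
noncomputable def lambda2P4 (c₁ c₂ c₃ : ℝ) : ℝ :=
  sInf {R : ℝ | ∃ x : Fin 4 → ℝ, x ≠ 0 ∧ x 0 + x 1 + x 2 + x 3 = 0 ∧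
    R = ((lapP4 c₁ c₂ c₃).mulVec x ⬝ᵥ x) / (x ⬝ᵥ x)}

/-- The Dirichlet form of the weighted path `P₄`. -/
def dirichletP4 (c₁ c₂ c₃ : ℝ) (x : Fin 4 → ℝ) : ℝ :=
  c₁ * (x 0 - x 1) ^ 2 + c₂ * (x 1 - x 2) ^ 2 + c₃ * (x 2 - x 3) ^ 2

/-- The energy, for edge resistances `r₁, r₂, r₃`, of the unique flow on `P₄` with divergence `x`
(where `x` has zero sum). -/
def flowEnergyP4 (r₁ r₂ r₃ : ℝ) (x : Fin 4 → ℝ) : ℝ :=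
  r₁ * x 0 ^ 2 + r₂ * (x 0 + x 1) ^ 2 + r₃ * x 3 ^ 2

theorem lapP4_mulVec_dotProduct (c₁ c₂ c₃ : ℝ) (x : Fin 4 → ℝ) :
    (lapP4 c₁ c₂ c₃).mulVec x ⬝ᵥ x = dirichletP4 c₁ c₂ c₃ x := by
  simp [lapP4, dirichletP4, Matrix.mulVec, dotProduct, Fin.sum_univ_four]
  ring

theorem dotProduct_self_fin_four (x : Fin 4 → ℝ) :
    x ⬝ᵥ x = x 0 ^ 2 + x 1 ^ 2 + x 2 ^ 2 + x 3 ^ 2 := by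
  simp only [dotProduct, Fin.sum_univ_four]
  ring

theorem dotProduct_self_pos_of_ne_zero {x : Fin 4 → ℝ} (hx : x ≠ 0) : 0 < x ⬝ᵥ x := by
  have h : 0 ≤ x ⬝ᵥ x := by rw [dotProduct_self_fin_four]; positivity
  exact lt_of_le_of_ne h fun h0 => hx (dotProduct_self_eq_zero.mp h0.symm)

theorem isCompact_unit_zero_sum :
    IsCompact {x : Fin 4 → ℝ | x 0 + x 1 + x 2 + x 3 = 0 ∧ x ⬝ᵥ x = 1} := by
  refine Metric.isCompact_of_isClosed_isBounded ?_ ?_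
  · simp only [dotProduct_self_fin_four]
    exact (isClosed_eq (by fun_prop) continuous_const).inter
      (isClosed_eq (by fun_prop) continuous_const)
  · refine (Metric.isBounded_closedBall (x := (0 : Fin 4 → ℝ)) (r := 1)).subset ?_
    rintro x ⟨-, hx⟩
    rw [mem_closedBall_zero_iff, pi_norm_le_iff_of_nonneg zero_le_one]
    intro i
    rw [Real.norm_eq_abs, ← sq_le_one_iff_abs_le_one, ← hx, sq]
    exact Finset.single_le_sum (f := fun j => x j * x j) (fun j _ => mul_self_nonneg _)
      (Finset.mem_univ i)

theorem lambda2P4_le {c₁ c₂ c₃ : ℝ} (hc₁ : 0 < c₁) (hc₂ : 0 < c₂) (hc₃ : 0 < c₃)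
    {x : Fin 4 → ℝ} (hsum : x 0 + x 1 + x 2 + x 3 = 0) :
    lambda2P4 c₁ c₂ c₃ * (x ⬝ᵥ x) ≤ dirichletP4 c₁ c₂ c₃ x := by
  rcases eq_or_ne x 0 with rfl | hx
  · simp [dirichletP4]
  rw [← le_div_iff₀ (dotProduct_self_pos_of_ne_zero hx), ← lapP4_mulVec_dotProduct]
  refine csInf_le ⟨0, ?_⟩ ⟨x, hx, hsum, rfl⟩
  rintro R ⟨y, hy, -, rfl⟩
  rw [lapP4_mulVec_dotProduct]
  refine div_nonneg ?_ (dotProduct_self_pos_of_ne_zero hy).le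
  unfold dirichletP4
  positivity

theorem exists_dirichletP4_eq_lambda2P4 (c₁ c₂ c₃ : ℝ) :
    ∃ x : Fin 4 → ℝ, x ≠ 0 ∧ x 0 + x 1 + x 2 + x 3 = 0 ∧
      dirichletP4 c₁ c₂ c₃ x = lambda2P4 c₁ c₂ c₃ * (x ⬝ᵥ x) := by
  have hne : {x : Fin 4 → ℝ | x 0 + x 1 + x 2 + x 3 = 0 ∧ x ⬝ᵥ x = 1}.Nonempty := by
    refine ⟨![1 / 2, 1 / 2, -1 / 2, -1 / 2], ?_, ?_⟩
    · simp; norm_num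
    · rw [dotProduct_self_fin_four]; simp; norm_num
  have hcont : Continuous (dirichletP4 c₁ c₂ c₃) := by
    unfold dirichletP4
    fun_prop
  obtain ⟨x, ⟨hsum, hunit⟩, hmin⟩ :=
    isCompact_unit_zero_sum.exists_isMinOn hne hcont.continuousOn
  have hx : x ≠ 0 := by
    rintro rfl
    simp at hunit
  refine ⟨x, hx, hsum, ?_⟩
  rw [hunit, mul_one]
  refine (IsLeast.csInf_eq ⟨?_, ?_⟩).symm
  · refine ⟨x, hx, hsum, ?_⟩
    rw [lapP4_mulVec_dotProduct, hunit, div_one]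
  · rintro R ⟨y, hy, hysum, rfl⟩
    have hpos := dotProduct_self_pos_of_ne_zero hy
    have hs : √(y ⬝ᵥ y) ^ 2 = y ⬝ᵥ y := Real.sq_sqrt hpos.le
    have hs0 : √(y ⬝ᵥ y) ≠ 0 := (Real.sqrt_pos.mpr hpos).ne'
    have hmem : (√(y ⬝ᵥ y))⁻¹ • y ∈
        {x : Fin 4 → ℝ | x 0 + x 1 + x 2 + x 3 = 0 ∧ x ⬝ᵥ x = 1} := by
      constructor
      · simp only [Pi.smul_apply, smul_eq_mul, ← mul_add, hysum, mul_zero]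
      · rw [smul_dotProduct, dotProduct_smul, smul_eq_mul, smul_eq_mul, ← hs]
        simp only [Real.sqrt_sq (Real.sqrt_nonneg _)]
        field_simp
    have h := isMinOn_iff.mp hmin _ hmem
    have hscale : dirichletP4 c₁ c₂ c₃ ((√(y ⬝ᵥ y))⁻¹ • y)
        = dirichletP4 c₁ c₂ c₃ y / (y ⬝ᵥ y) := by
      rw [div_eq_inv_mul]
      nth_rewrite 2 [← hs]
      simp only [dirichletP4, Pi.smul_apply, smul_eq_mul]
      ring
    rwa [lapP4_mulVec_dotProduct, ← hscale]

theorem lambda2P4_pos {c₁ c₂ c₃ : ℝ} (hc₁ : 0 < c₁) (hc₂ : 0 < c₂) (hc₃ : 0 < c₃) :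
    0 < lambda2P4 c₁ c₂ c₃ := by
  obtain ⟨x, hx, hsum, heq⟩ := exists_dirichletP4_eq_lambda2P4 c₁ c₂ c₃
  refine pos_of_mul_pos_left (b := x ⬝ᵥ x) ?_ (dotProduct_self_pos_of_ne_zero hx).le
  rw [← heq]
  by_contra! hle
  unfold dirichletP4 at hle
  have p₁ := mul_nonneg hc₁.le (sq_nonneg (x 0 - x 1))
  have p₂ := mul_nonneg hc₂.le (sq_nonneg (x 1 - x 2))
  have p₃ := mul_nonneg hc₃.le (sq_nonneg (x 2 - x 3))
  have h₁ : x 0 - x 1 = 0 := by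
    simpa [hc₁.ne'] using (show c₁ * (x 0 - x 1) ^ 2 = 0 by linarith)
  have h₂ : x 1 - x 2 = 0 := by
    simpa [hc₂.ne'] using (show c₂ * (x 1 - x 2) ^ 2 = 0 by linarith)
  have h₃ : x 2 - x 3 = 0 := by
    simpa [hc₃.ne'] using (show c₃ * (x 2 - x 3) ^ 2 = 0 by linarith)
  apply hx
  ext i
  fin_cases i <;> simp <;> linarith

/-- Cauchy–Schwarz duality between potentials and flows. -/
theorem sq_dotProduct_self_le {r₁ r₂ r₃ : ℝ} (hr₁ : 0 < r₁) (hr₂ : 0 < r₂) (hr₃ : 0 < r₃)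
    {x : Fin 4 → ℝ} (hsum : x 0 + x 1 + x 2 + x 3 = 0) :
    (x ⬝ᵥ x) ^ 2 ≤ flowEnergyP4 r₁ r₂ r₃ x * dirichletP4 r₁⁻¹ r₂⁻¹ r₃⁻¹ x := by
  have hparts : x ⬝ᵥ x =
      x 0 * (x 0 - x 1) + (x 0 + x 1) * (x 1 - x 2) + -x 3 * (x 2 - x 3) := by
    rw [dotProduct_self_fin_four]
    linear_combination x 2 * hsum
  have h := Finset.sum_sq_le_sum_mul_sum_of_sq_le_mul (Finset.univ : Finset (Fin 3))
    (r := ![x 0 * (x 0 - x 1), (x 0 + x 1) * (x 1 - x 2), -x 3 * (x 2 - x 3)])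
    (f := ![r₁ * x 0 ^ 2, r₂ * (x 0 + x 1) ^ 2, r₃ * x 3 ^ 2])
    (g := ![r₁⁻¹ * (x 0 - x 1) ^ 2, r₂⁻¹ * (x 1 - x 2) ^ 2, r₃⁻¹ * (x 2 - x 3) ^ 2])
    (fun i _ => by fin_cases i <;> simp <;> positivity)
    (fun i _ => by fin_cases i <;> simp <;> positivity)
    (fun i _ => by fin_cases i <;> simp <;> field_simp <;> rfl)
  rw [hparts]
  simpa [Fin.sum_univ_three, flowEnergyP4, dirichletP4] using h

/-- A lower bound `l` on the Rayleigh quotient bounds the flow energy by `⟨x, x⟩ / l`, and in the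
case of equality `x / l` is the potential of the flow with divergence `x`. -/
theorem flowEnergyP4_bound {r₁ r₂ r₃ l : ℝ} (hr₁ : 0 < r₁) (hr₂ : 0 < r₂) (hr₃ : 0 < r₃)
    (hl : 0 < l)
    (hray : ∀ y : Fin 4 → ℝ, y 0 + y 1 + y 2 + y 3 = 0 →
      l * (y ⬝ᵥ y) ≤ dirichletP4 r₁⁻¹ r₂⁻¹ r₃⁻¹ y)
    {x : Fin 4 → ℝ} (hsum : x 0 + x 1 + x 2 + x 3 = 0) :
    l * flowEnergyP4 r₁ r₂ r₃ x ≤ x ⬝ᵥ x ∧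
      (l * flowEnergyP4 r₁ r₂ r₃ x = x ⬝ᵥ x →
        x 0 - x 1 = l * (r₁ * x 0) ∧ x 2 - x 3 = -(l * (r₃ * x 3))) := by
  obtain ⟨t, ht⟩ : ∃ t, t = (r₁ * x 0 + 2 * (r₂ * (x 0 + x 1)) - 3 * (r₃ * x 3)) / -4 := ⟨_, rfl⟩
  obtain ⟨y, hy⟩ : ∃ y : Fin 4 → ℝ, y = ![t + r₁ * x 0 + r₂ * (x 0 + x 1) - r₃ * x 3,
    t + r₂ * (x 0 + x 1) - r₃ * x 3, t - r₃ * x 3, t] := ⟨_, rfl⟩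
  have h0 : y 0 = t + r₁ * x 0 + r₂ * (x 0 + x 1) - r₃ * x 3 := by simp [hy]
  have h1 : y 1 = t + r₂ * (x 0 + x 1) - r₃ * x 3 := by simp [hy]
  have h2 : y 2 = t - r₃ * x 3 := by simp [hy]
  have h3 : y 3 = t := by simp [hy]
  have hE : dirichletP4 r₁⁻¹ r₂⁻¹ r₃⁻¹ y = flowEnergyP4 r₁ r₂ r₃ x := by
    simp only [dirichletP4, flowEnergyP4, h0, h1, h2, h3]
    field_simp
    ring
  have hxy : x ⬝ᵥ y = flowEnergyP4 r₁ r₂ r₃ x := by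
    simp only [dotProduct, Fin.sum_univ_four, flowEnergyP4, h0, h1, h2, h3]
    linear_combination (t - r₃ * x 3) * hsum
  have hb := hray y (by rw [h0, h1, h2, h3, ht]; ring)
  rw [hE] at hb
  have hexp : (l • y - x) ⬝ᵥ (l • y - x) =
      l * (l * (y ⬝ᵥ y)) - 2 * (l * (x ⬝ᵥ y)) + x ⬝ᵥ x := by
    simp only [dotProduct, Fin.sum_univ_four, Pi.sub_apply, Pi.smul_apply, smul_eq_mul]
    ring
  have hle : (l • y - x) ⬝ᵥ (l • y - x) ≤ x ⬝ᵥ x - l * flowEnergyP4 r₁ r₂ r₃ x := by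
    rw [hexp, hxy]
    linarith [mul_le_mul_of_nonneg_left hb hl.le]
  have hnn : 0 ≤ (l • y - x) ⬝ᵥ (l • y - x) := by
    rw [dotProduct_self_fin_four]
    positivity
  refine ⟨by linarith, fun heq => ?_⟩
  have hz : l • y - x = 0 := dotProduct_self_eq_zero.mp (by linarith)
  have hi (i : Fin 4) : x i = l * y i := by
    have := congrFun hz i
    simp only [Pi.sub_apply, Pi.smul_apply, smul_eq_mul, Pi.zero_apply] at this
    linarith
  constructor
  · linear_combination hi 0 - hi 1 + l * (h0 - h1)
  · linear_combination hi 2 - hi 3 + l * (h2 - h3)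

/-- **Optimal weights for `P₄` are symmetric.**
If `c₁, c₂, c₃ > 0` are edge weights on the path `P₄` with total effective resistance
`3/c₁ + 4/c₂ + 3/c₃ = 10`, and they maximize the algebraic connectivity among all positive
weights with the same total effective resistance, then `c₁ = c₃`. -/
theorem lambda2P4_maximizer_symmetric
    (c₁ c₂ c₃ : ℝ) (hc₁ : 0 < c₁) (hc₂ : 0 < c₂) (hc₃ : 0 < c₃)
    (hres : 3 / c₁ + 4 / c₂ + 3 / c₃ = 10)
    (hmax : ∀ c₁' c₂' c₃' : ℝ, 0 < c₁' → 0 < c₂' → 0 < c₃' →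
      3 / c₁' + 4 / c₂' + 3 / c₃' = 10 →
      lambda2P4 c₁' c₂' c₃' ≤ lambda2P4 c₁ c₂ c₃) :
    c₁ = c₃ := by
  obtain ⟨r₁, hr₁, rfl⟩ : ∃ r, 0 < r ∧ c₁ = r⁻¹ := ⟨c₁⁻¹, by positivity, by simp⟩
  obtain ⟨r₂, hr₂, rfl⟩ : ∃ r, 0 < r ∧ c₂ = r⁻¹ := ⟨c₂⁻¹, by positivity, by simp⟩
  obtain ⟨r₃, hr₃, rfl⟩ : ∃ r, 0 < r ∧ c₃ = r⁻¹ := ⟨c₃⁻¹, by positivity, by simp⟩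
  obtain ⟨m, hm⟩ : ∃ m, m = (r₁ + r₃) / 2 := ⟨_, rfl⟩
  have hm0 : 0 < m := by rw [hm]; positivity
  have hle := hmax m⁻¹ r₂⁻¹ m⁻¹ (by positivity) hc₂ (by positivity) (by
    simp only [div_inv_eq_mul] at hres ⊢
    linear_combination hres + 6 * hm)
  obtain ⟨x, hx, hsum, heq⟩ := exists_dirichletP4_eq_lambda2P4 m⁻¹ r₂⁻¹ m⁻¹
  have hl := lambda2P4_pos hc₁ hc₂ hc₃
  have hray := fun (y : Fin 4 → ℝ) => lambda2P4_le (x := y) hc₁ hc₂ hc₃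
  have hcs := sq_dotProduct_self_le hm0 hr₂ hm0 hsum
  rw [heq] at hcs
  generalize lambda2P4 r₁⁻¹ r₂⁻¹ r₃⁻¹ = l at hle hl hray
  generalize lambda2P4 m⁻¹ r₂⁻¹ m⁻¹ = l' at hle hcs
  have hxpos := dotProduct_self_pos_of_ne_zero hx
  have hE0 : 0 ≤ flowEnergyP4 m r₂ m x := by unfold flowEnergyP4; positivity
  have hlower : x ⬝ᵥ x ≤ l * flowEnergyP4 m r₂ m x := by
    have : x ⬝ᵥ x ≤ l' * flowEnergyP4 m r₂ m x :=
      le_of_mul_le_mul_right (by linarith) hxpos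
    exact this.trans (mul_le_mul_of_nonneg_right hle hE0)
  have hray' : ∀ y : Fin 4 → ℝ, y 0 + y 1 + y 2 + y 3 = 0 →
      l * (y ⬝ᵥ y) ≤ dirichletP4 r₃⁻¹ r₂⁻¹ r₁⁻¹ y := by
    intro y hy
    have h := hray ![y 3, y 2, y 1, y 0] (by simp; linarith)
    simp only [dotProduct_self_fin_four, dirichletP4] at h ⊢
    simp at h
    linarith
  obtain ⟨hub, hpot⟩ := flowEnergyP4_bound hr₁ hr₂ hr₃ hl hray hsum
  obtain ⟨hub', hpot'⟩ := flowEnergyP4_bound hr₃ hr₂ hr₁ hl hray' hsum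
  have havg : l * flowEnergyP4 m r₂ m x =
      (l * flowEnergyP4 r₁ r₂ r₃ x + l * flowEnergyP4 r₃ r₂ r₁ x) / 2 := by
    simp only [flowEnergyP4, hm]
    ring
  obtain ⟨h₁, h₃⟩ := hpot (by linarith)
  obtain ⟨h₁', h₃'⟩ := hpot' (by linarith)
  by_contra hne
  have hd : l * (r₁ - r₃) ≠ 0 :=
    mul_ne_zero hl.ne' (sub_ne_zero.mpr fun h => hne (by rw [h]))
  have hx0 : x 0 = 0 := (mul_eq_zero_iff_left hd).mp (by linear_combination h₁' - h₁)
  have hx3 : x 3 = 0 := (mul_eq_zero_iff_left hd).mp (by linear_combination h₃' - h₃)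
  rw [hx0] at h₁
  rw [hx3] at h₃
  apply hx
  ext i
  fin_cases i <;> simp <;> linarith
end
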